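/- arXiv:2603.14142 — 2 statements merged into one kernel-verified Lean document; each statement's English description precedes it below -/
import Mathlib

section
/- Let A be a complex matrix such that A*A admits a von Neumann inverse Y (i.e. A*A·Y·A*A = A*A) and suppose rank(A*A) = rank(A). Then X = Y·A* is a (1,3)-inverse of A, i.e. AXA = A and (AX)* = AX. -/
open Matrix

theorem vonNeumann_gives_one_three_inverse {m n : ℕ}
    (A : Matrix (Fin m) (Fin n) ℂ) (Y : Matrix (Fin n) (Fin n) ℂ)
    (hY : (Aᴴ * A) * Y * (Aᴴ * A) = Aᴴ * A)
    (hrank : (Aᴴ * A).rank = A.rank) :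
    A * (Y * Aᴴ) * A = A ∧ (A * (Y * Aᴴ))ᴴ = A * (Y * Aᴴ) := by
  have h1 : A * (Y * Aᴴ) * A = A := by
    have h0 : (Aᴴ * A) * (Y * (Aᴴ * A) - 1) = 0 := by
      rw [Matrix.mul_sub, ← Matrix.mul_assoc, hY, Matrix.mul_one, sub_self]
    open scoped ComplexOrder in
    have h2 := (Matrix.conjTranspose_mul_self_mul_eq_zero A _).1 h0
    rw [Matrix.mul_sub, Matrix.mul_one, sub_eq_zero] at h2
    simpa only [Matrix.mul_assoc] using h2
  refine ⟨h1, ?_⟩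
  have h3 : Aᴴ * (A * (Y * Aᴴ))ᴴ = Aᴴ := by
    rw [← Matrix.conjTranspose_mul, h1]
  have h4 : (A * (Y * Aᴴ))ᴴ = A * (Yᴴ * Aᴴ) := by
    simp [Matrix.conjTranspose_mul, Matrix.mul_assoc]
  calc (A * (Y * Aᴴ))ᴴ = (A * (Y * Aᴴ) * A) * (Yᴴ * Aᴴ) := by rw [h1, h4]
    _ = A * (Y * (Aᴴ * (A * (Y * Aᴴ))ᴴ)) := by rw [h4]; simp only [Matrix.mul_assoc]
    _ = A * (Y * Aᴴ) := by rw [h3]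
end

section
/- Let M be the double star block matrix with xᵀy = 0 = zᵀw and a, b ≠ 0, and suppose r := aā + w*w ≠ 0 and h := bb̄ + y*y ≠ 0. Then the matrix X = [[0, h⁻¹y*, b̄h⁻¹, 0],[ā(br)⁻¹y, 0, 0, (br)⁻¹yw*],[ār⁻¹, 0, 0, r⁻¹w*],[0, (ah)⁻¹wy*, b̄(ah)⁻¹w, 0]] is the core EP inverse of M: it satisfies X M³ = M², M X² = X, and (MX)* = MX. -/
open Matrix BigOperators

noncomputable section

abbrev Idx (m n : ℕ) := (Unit ⊕ Fin m) ⊕ (Unit ⊕ Fin n)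

/-- 4×4 block builder for matrices indexed by a double star digraph vertex set:
the blocks correspond to the first center, the first star's leaves, the second
center and the second star's leaves, in this order. -/
def blk {m n : ℕ}
    (A11 : ℂ) (A12 : Fin m → ℂ) (A13 : ℂ) (A14 : Fin n → ℂ)
    (A21 : Fin m → ℂ) (A22 : Fin m → Fin m → ℂ) (A23 : Fin m → ℂ) (A24 : Fin m → Fin n → ℂ)
    (A31 : ℂ) (A32 : Fin m → ℂ) (A33 : ℂ) (A34 : Fin n → ℂ)
    (A41 : Fin n → ℂ) (A42 : Fin n → Fin m → ℂ) (A43 : Fin n → ℂ) (A44 : Fin n → Fin n → ℂ) :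
    Matrix (Idx m n) (Idx m n) ℂ :=
  Matrix.of fun i j =>
    match i, j with
    | .inl (.inl _), .inl (.inl _) => A11
    | .inl (.inl _), .inl (.inr k) => A12 k
    | .inl (.inl _), .inr (.inl _) => A13
    | .inl (.inl _), .inr (.inr k) => A14 k
    | .inl (.inr i'), .inl (.inl _) => A21 i'
    | .inl (.inr i'), .inl (.inr k) => A22 i' k
    | .inl (.inr i'), .inr (.inl _) => A23 i'
    | .inl (.inr i'), .inr (.inr k) => A24 i' k
    | .inr (.inl _), .inl (.inl _) => A31
    | .inr (.inl _), .inl (.inr k) => A32 k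
    | .inr (.inl _), .inr (.inl _) => A33
    | .inr (.inl _), .inr (.inr k) => A34 k
    | .inr (.inr i'), .inl (.inl _) => A41 i'
    | .inr (.inr i'), .inl (.inr k) => A42 i' k
    | .inr (.inr i'), .inr (.inl _) => A43 i'
    | .inr (.inr i'), .inr (.inr k) => A44 i' k

/-- The canonical matrix `[[0, xᵀ, a, 0],[y, 0, 0, 0],[b, 0, 0, zᵀ],[0, 0, w, 0]]`
associated with a double star digraph. -/
def dsM {m n : ℕ} (a b : ℂ) (x y : Fin m → ℂ) (z w : Fin n → ℂ) :
    Matrix (Idx m n) (Idx m n) ℂ :=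
  blk 0 x a (fun _ => 0)
      y (fun _ _ => 0) (fun _ => 0) (fun _ _ => 0)
      b (fun _ => 0) 0 z
      (fun _ => 0) (fun _ _ => 0) w (fun _ _ => 0)

/-- `xᵀy`. -/
def dotT {k : ℕ} (x y : Fin k → ℂ) : ℂ := ∑ i, x i * y i

/-- `x*x = ∑ conj xᵢ · xᵢ`. -/
def gram {k : ℕ} (x : Fin k → ℂ) : ℂ := ∑ i, star (x i) * x i

end

set_option maxHeartbeats 4000000 in
theorem dsM_coreEP_caseI {m n : ℕ} (a b : ℂ) (ha : a ≠ 0) (hb : b ≠ 0)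
    (x y : Fin m → ℂ) (z w : Fin n → ℂ)
    (hxy : dotT x y = 0) (hzw : dotT z w = 0)
    (hr : a * star a + gram w ≠ 0) (hh : b * star b + gram y ≠ 0) :
    letI M := dsM a b x y z w
    letI r := a * star a + gram w
    letI h := b * star b + gram y
    letI X := blk 0 (fun j => h⁻¹ * star (y j)) (star b * h⁻¹) (fun _ => 0)
        (fun i => star a * (b * r)⁻¹ * y i) (fun _ _ => 0) (fun _ => 0)
          (fun i j => (b * r)⁻¹ * y i * star (w j))
        (star a * r⁻¹) (fun _ => 0) 0 (fun j => r⁻¹ * star (w j))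
        (fun _ => 0) (fun i j => (a * h)⁻¹ * w i * star (y j))
          (fun i => star b * (a * h)⁻¹ * w i) (fun _ _ => 0)
    X * M ^ 3 = M ^ 2 ∧ M * X ^ 2 = X ∧ (M * X)ᴴ = M * X := by
  have hxy' : ∑ i, x i * y i = 0 := hxy
  have hzw' : ∑ i, z i * w i = 0 := hzw
  have hy' : ∑ i, star (y i) * y i = gram y := rfl
  have hw' : ∑ i, star (w i) * w i = gram w := rfl
  have sx : ∀ c : ℂ, ∑ i, x i * (y i * c) = 0 := fun c => by
    simp only [← mul_assoc, ← Finset.sum_mul, hxy', zero_mul]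
  have sz : ∀ c : ℂ, ∑ i, z i * (w i * c) = 0 := fun c => by
    simp only [← mul_assoc, ← Finset.sum_mul, hzw', zero_mul]
  have sy : ∀ c d : ℂ, ∑ i, d * star (y i) * (y i * c) = d * gram y * c := fun c d => by
    rw [← hy', Finset.mul_sum, Finset.sum_mul]
    exact Finset.sum_congr rfl fun i _ => by ring
  have sw : ∀ c d : ℂ, ∑ i, d * star (w i) * (w i * c) = d * gram w * c := fun c d => by
    rw [← hw', Finset.mul_sum, Finset.sum_mul]
    exact Finset.sum_congr rfl fun i _ => by ring
  have gy : star (gram y) = gram y := by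
    simp only [_root_.gram, star_sum, star_mul', star_star]
    exact Finset.sum_congr rfl fun i _ => by ring
  have gw : star (gram w) = gram w := by
    simp only [_root_.gram, star_sum, star_mul', star_star]
    exact Finset.sum_congr rfl fun i _ => by ring
  set r := a * star a + _root_.gram w with hrd
  set h := b * star b + _root_.gram y with hhd
  generalize hM0 : dsM a b x y z w = M
  generalize hX0 : blk 0 (fun j => h⁻¹ * star (y j)) (star b * h⁻¹) (fun _ => 0)
        (fun i => star a * (b * r)⁻¹ * y i) (fun _ _ => 0) (fun _ => 0)
          (fun i j => (b * r)⁻¹ * y i * star (w j))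
        (star a * r⁻¹) (fun _ => 0) 0 (fun j => r⁻¹ * star (w j))
        (fun _ => 0) (fun i j => (a * h)⁻¹ * w i * star (y j))
          (fun i => star b * (a * h)⁻¹ * w i) (fun _ _ => 0) = X
  have hr0 : r ≠ 0 := hr
  have hh0 : h ≠ 0 := hh
  have hrs : star r = r := by
    simp only [hrd, star_add, star_mul', star_star, gw]; ring
  have hhs : star h = h := by
    simp only [hhd, star_add, star_mul', star_star, gy]; ring
  have er : gram w = r - a * star a := by simp only [hrd]; ring
  have eh : gram y = h - b * star b := by simp only [hhd]; ring
  have hM : M = blk 0 x a (fun _ => 0)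
      (fun i => y i * 1) (fun _ _ => 0) (fun _ => 0) (fun _ _ => 0)
      b (fun _ => 0) 0 z
      (fun _ => 0) (fun _ _ => 0) (fun i => w i * 1) (fun _ _ => 0) := by
    simp only [← hM0, dsM, mul_one]
  have hX : X = blk 0 (fun j => h⁻¹ * star (y j)) (star b * h⁻¹) (fun _ => 0)
        (fun i => y i * (star a * (b * r)⁻¹)) (fun _ _ => 0) (fun _ => 0)
          (fun i j => y i * ((b * r)⁻¹ * star (w j)))
        (star a * r⁻¹) (fun _ => 0) 0 (fun j => r⁻¹ * star (w j))
        (fun _ => 0) (fun i j => w i * ((a * h)⁻¹ * star (y j)))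
          (fun i => w i * (star b * (a * h)⁻¹)) (fun _ _ => 0) := by
    ext ((i | i) | (i | i)) ((j | j) | (j | j)) <;> simp only [← hX0, blk, Matrix.of_apply] <;> ring
  clear_value r h
  have h2 : M ^ 2 = blk (a * b) (fun _ => 0) 0 (fun j => a * z j)
      (fun _ => 0) (fun i j => y i * x j) (fun i => y i * a) (fun _ _ => 0)
      0 (fun j => b * x j) (a * b) (fun _ => 0)
      (fun i => w i * b) (fun _ _ => 0) (fun _ => 0) (fun i j => w i * z j) := by
    rw [pow_two, hM]
    ext ((i | i) | (i | i)) ((j | j) | (j | j)) <;>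
      simp [blk, Matrix.mul_apply, Fintype.sum_sum_type, hxy', hzw', mul_comm b a]
  have h3 : M ^ 3 = blk 0 (fun j => a * b * x j) (a * b * a) (fun _ => 0)
      (fun i => y i * (a * b)) (fun _ _ => 0) (fun _ => 0) (fun i j => y i * (a * z j))
      (a * b * b) (fun _ => 0) 0 (fun j => a * b * z j)
      (fun _ => 0) (fun i j => w i * (b * x j)) (fun i => w i * (a * b)) (fun _ _ => 0) := by
    rw [pow_succ', h2, hM]
    ext ((i | i) | (i | i)) ((j | j) | (j | j)) <;>
      simp only [blk, Matrix.mul_apply, Matrix.of_apply, Fintype.sum_sum_type,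
        Finset.univ_unique, Finset.sum_singleton, sx, sz, mul_zero, zero_mul,
        Finset.sum_const_zero, add_zero, zero_add] <;> ring
  have hP : M * X = blk (a * star a * r⁻¹) (fun _ => 0) 0 (fun j => a * r⁻¹ * star (w j))
      (fun _ => 0) (fun i j => y i * h⁻¹ * star (y j)) (fun i => y i * (star b * h⁻¹))
        (fun _ _ => 0)
      0 (fun j => b * h⁻¹ * star (y j)) (b * star b * h⁻¹) (fun _ => 0)
      (fun i => w i * (star a * r⁻¹)) (fun _ _ => 0) (fun _ => 0)
        (fun i j => w i * r⁻¹ * star (w j)) := by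
    rw [hX, hM]
    ext ((i | i) | (i | i)) ((j | j) | (j | j)) <;>
      simp only [blk, Matrix.mul_apply, Matrix.of_apply, Fintype.sum_sum_type,
        Finset.univ_unique, Finset.sum_singleton, sx, sz, mul_zero, zero_mul,
        Finset.sum_const_zero, add_zero, zero_add] <;> ring
  refine ⟨?_, ?_, ?_⟩
  · rw [h3, h2, hX]
    ext ((i | i) | (i | i)) ((j | j) | (j | j)) <;>
      simp only [blk, Matrix.mul_apply, Matrix.of_apply, Fintype.sum_sum_type,
        Finset.univ_unique, Finset.sum_singleton, ← mul_assoc (y _) _ (star _),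
        ← mul_assoc (w _) _ (star _), sy, sw, mul_zero, zero_mul,
        Finset.sum_const_zero, add_zero, zero_add, er, eh] <;> field_simp <;> ring
  · rw [pow_two, ← mul_assoc, hP, hX]
    ext ((i | i) | (i | i)) ((j | j) | (j | j)) <;>
      simp only [blk, Matrix.mul_apply, Matrix.of_apply, Fintype.sum_sum_type,
        Finset.univ_unique, Finset.sum_singleton, sy, sw, mul_zero, zero_mul,
        Finset.sum_const_zero, add_zero, zero_add, er, eh] <;> field_simp <;> ring
  · rw [hP]
    ext ((i | i) | (i | i)) ((j | j) | (j | j)) <;>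
      simp only [blk, Matrix.conjTranspose_apply, Matrix.of_apply, star_mul', star_inv₀, star_star,
        star_zero, hrs, hhs] <;> ring
end
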